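/- arXiv:1111.0582 — 2 statements merged into one kernel-verified Lean document; each statement's English description precedes it below -/
import Mathlib

section
/- Let F be a field and n, k, t positive integers with |F| > t·n·k². Let V_1, …, V_t be F-linear subspaces, each of dimension at most k, of the F-span of the variables x_1, …, x_n inside the polynomial ring F[x_1, …, x_n]. For α ∈ F, let Ψ_α : F[x_1, …, x_n] → F[y_1, …, y_k] be the F-algebra homomorphism with Ψ_α(x_i) = Σ_{j=1}^{k} y_j·α^{i·j}. Then there exists α ∈ F such that Ψ_α restricts to an injective F-linear map on each of V_1, …, V_t. -/
lemma aux_perm {r : ℕ} (e : Fin r → ℕ) (he : StrictMono e) (σ : Equiv.Perm (Fin r)) (hσ : σ ≠ 1) :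
    ∑ i, e (σ i) * (i.1 + 1) < ∑ i, e i * (i.1 + 1) := by
  have hg : StrictMono (fun i : Fin r => i.1 + 1) := fun a b h => by
    have : a.1 < b.1 := h
    simpa using this
  have hm : Monovary e (fun i : Fin r => i.1 + 1) := he.monotone.monovary hg.monotone
  refine (hm.sum_comp_perm_mul_lt_sum_mul_iff (σ := σ)).2 fun h => hσ ?_
  have h1 : Monotone (e ∘ σ) := hg.trans_monovary h
  have h2 : Monotone σ := fun a b hab => he.le_iff_le.1 (h1 hab)
  have h3 : StrictMono σ := h2.strictMono_of_injective σ.injective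
  have h4 : (σ : Fin r → Fin r) = id :=
    (StrictMono.range_inj h3 strictMono_id).1 (by simp [σ.surjective.range_eq])
  ext i
  simp [h4]

open Polynomial in
lemma aux_det {F : Type*} [Field F] {r : ℕ} (q : Fin r → F[X]) (h0 : ∀ i, q i ≠ 0)
    (he : StrictMono (fun i => (q i).natDegree)) :
    (Matrix.of fun a b : Fin r => expand F (b.1 + 1) (q a)).det ≠ 0 := by
  have key : (Matrix.of fun a b : Fin r => expand F (b.1 + 1) (q a)).det.coeff
      (∑ i, (q i).natDegree * (i.1 + 1)) = ∏ i, (q i).leadingCoeff := by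
    rw [Matrix.det_apply, finsetSum_coeff, Finset.sum_eq_single 1]
    · have h1 : (∏ i : Fin r, expand F (i.1 + 1) (q i)).natDegree
          = ∑ i, (q i).natDegree * (i.1 + 1) := by
        rw [natDegree_prod _ _ (fun i _ => by
          rw [Ne, expand_eq_zero (Nat.succ_pos _)]; exact h0 i)]
        simp [natDegree_expand]
      have h2 : (∏ i : Fin r, expand F (i.1 + 1) (q i)).leadingCoeff
          = ∏ i, (q i).leadingCoeff := by
        rw [leadingCoeff_prod]
        exact Finset.prod_congr rfl fun i _ => leadingCoeff_expand (Nat.succ_pos _)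
      rw [← h2, leadingCoeff, h1]
      simp
    · intro σ _ hσ
      rw [coeff_smul, coeff_eq_zero_of_natDegree_lt, smul_zero]
      refine lt_of_le_of_lt (natDegree_prod_le _ _) ?_
      simpa [natDegree_expand] using aux_perm _ he σ hσ
    · simp
  intro h
  rw [h] at key
  simp only [coeff_zero] at key
  exact Finset.prod_ne_zero_iff.2 (fun i _ => leadingCoeff_ne_zero.2 (h0 i)) key.symm

open Polynomial in
lemma aux_main {F : Type*} [Field F] {n k : ℕ} (W : Submodule F F[X]) [FiniteDimensional F W]
    (hW : ∀ p ∈ W, p.natDegree ≤ n) (hk : Module.finrank F W ≤ k) :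
    ∃ Q : F[X], Q ≠ 0 ∧ Q.natDegree ≤ n * k ^ 2 ∧ ∀ α, Q.eval α ≠ 0 →
      ∀ p ∈ W, (∀ b : Fin k, p.eval (α ^ (b.1 + 1)) = 0) → p = 0 := by
  classical
  let D : Finset ℕ := (Finset.range (n + 1)).filter (fun d => ∃ p ∈ W, p ≠ 0 ∧ p.natDegree = d)
  obtain ⟨r, hr⟩ : ∃ r, D.card = r := ⟨_, rfl⟩
  let e := D.orderEmbOfFin hr
  have hex : ∀ a, ∃ p ∈ W, p ≠ 0 ∧ p.natDegree = e a := fun a =>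
    (Finset.mem_filter.1 (D.orderEmbOfFin_mem hr a)).2
  choose q hqW hq0 hqd using hex
  have hdet := aux_det q hq0 (fun a b h => by simpa [hqd] using h)
  set M := (Matrix.of fun a b : Fin r => expand F (b.1 + 1) (q a)) with hM
  have hli : LinearIndependent F q := by
    rw [Fintype.linearIndependent_iff]
    intro c hc
    have : (fun a => Polynomial.C (c a)) = 0 := by
      apply Matrix.eq_zero_of_vecMul_eq_zero hdet
      ext1 b
      have := congrArg (expand F (b.1 + 1)) hc
      simpa [Matrix.vecMul, dotProduct, hM, smul_eq_C_mul] using this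
    intro i
    simpa using congrFun this i
  have hrk : r ≤ k := by
    have h2 : LinearIndependent F (fun a => (⟨q a, hqW a⟩ : W)) :=
      LinearIndependent.of_comp W.subtype hli
    simpa using h2.fintype_card_le_finrank.trans hk
  have hspan : ∀ m : ℕ, ∀ p ∈ W, p.degree < m → p ∈ Submodule.span F (Set.range q) := by
    intro m
    induction m with
    | zero =>
      intro p _ h
      have : p = 0 := by simpa using h
      simp [this]
    | succ m ih =>
      intro p hp h
      by_cases hm : p.degree < m
      · exact ih p hp hm
      have hp0 : p ≠ 0 := by rintro rfl; simp at hm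
      have hpd : p.natDegree = m := by
        rw [degree_eq_natDegree hp0] at h hm
        norm_cast at h hm
        omega
      have hD : p.natDegree ∈ D := Finset.mem_filter.2
        ⟨Finset.mem_range.2 (Nat.lt_succ_of_le (hW p hp)), p, hp, hp0, rfl⟩
      have : p.natDegree ∈ Set.range e := by
        rw [Finset.range_orderEmbOfFin]; exact hD
      obtain ⟨a, ha⟩ := this
      have hlc : (q a).leadingCoeff ≠ 0 := leadingCoeff_ne_zero.2 (hq0 a)
      have hlp : p.leadingCoeff ≠ 0 := leadingCoeff_ne_zero.2 hp0
      set s := (p.leadingCoeff / (q a).leadingCoeff) • q a with hs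
      have hc : p.leadingCoeff / (q a).leadingCoeff ≠ 0 := div_ne_zero hlp hlc
      have hsd : s.degree = p.degree := by
        rw [hs, smul_eq_C_mul, degree_C_mul hc, degree_eq_natDegree (hq0 a),
          degree_eq_natDegree hp0, hqd, ha]
      have hsl : s.leadingCoeff = p.leadingCoeff := by
        rw [hs, smul_eq_C_mul, leadingCoeff_mul, leadingCoeff_C, div_mul_cancel₀ _ hlc]
      have hlt : (p - s).degree < m := by
        have := degree_sub_lt hsd.symm hp0 hsl.symm
        rwa [degree_eq_natDegree hp0, hpd] at this
      have h1 := ih (p - s) (W.sub_mem hp (W.smul_mem _ (hqW a))) hlt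
      have h2 : s ∈ Submodule.span F (Set.range q) :=
        Submodule.smul_mem _ _ (Submodule.subset_span ⟨a, rfl⟩)
      simpa using Submodule.add_mem _ h1 h2
  refine ⟨M.det, hdet, ?_, ?_⟩
  · rw [Matrix.det_apply]
    refine natDegree_sum_le_of_forall_le _ _ fun σ _ => ?_
    refine (natDegree_smul_le _ _).trans ((natDegree_prod_le _ _).trans ?_)
    calc _ ≤ ∑ i : Fin r, n * k := by
          refine Finset.sum_le_sum fun i _ => ?_
          simp only [hM, Matrix.of_apply, natDegree_expand]
          exact Nat.mul_le_mul (hW _ (hqW _)) (by omega)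
      _ = r * (n * k) := by simp
      _ ≤ k * (n * k) := Nat.mul_le_mul_right _ hrk
      _ = n * k ^ 2 := by ring
  · intro α hα p hp hb
    have hps := hspan (p.natDegree + 1) p hp
      (lt_of_le_of_lt degree_le_natDegree (by exact_mod_cast Nat.lt_succ_self _))
    obtain ⟨c, rfl⟩ := (Submodule.mem_span_range_iff_exists_fun _).1 hps
    have hα' : (M.map (Polynomial.evalRingHom α)).det ≠ 0 := by
      have := RingHom.map_det (Polynomial.evalRingHom α) M
      rw [RingHom.mapMatrix_apply] at this
      rw [← this]
      exact hα
    have : c = 0 := by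
      apply Matrix.eq_zero_of_vecMul_eq_zero hα'
      ext b
      have := hb ⟨b.1, by omega⟩
      simpa [Matrix.vecMul, dotProduct, hM, expand_eval, eval_finsetSum] using this
    simp [this]

open MvPolynomial

theorem statement4 {F : Type*} [Field F] {n k t : ℕ}
    (hn : 0 < n) (hk : 0 < k) (ht : 0 < t)
    (hF : ((t * n * k ^ 2 : ℕ) : Cardinal) < Cardinal.mk F)
    (V : Fin t → Submodule F (MvPolynomial (Fin n) F))
    (hV : ∀ l, V l ≤ Submodule.span F (Set.range (X : Fin n → MvPolynomial (Fin n) F)))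
    (hdim : ∀ l, Module.finrank F (V l) ≤ k) :
    ∃ α : F, ∀ l, Set.InjOn
      (aeval fun i : Fin n => ∑ j : Fin k,
        MvPolynomial.C (α ^ ((i.1 + 1) * (j.1 + 1))) * (X j : MvPolynomial (Fin k) F))
      (V l : Set (MvPolynomial (Fin n) F)) := by
  classical
  let φ : MvPolynomial (Fin n) F →ₐ[F] Polynomial F := aeval fun i => Polynomial.X ^ (i.1 + 1)
  have hφ : ∀ c : Fin n → F, φ (∑ i, c i • X i) = ∑ i, c i • Polynomial.X ^ (i.1 + 1) := by
    intro c; simp [φ]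
  have hfin : ∀ l, FiniteDimensional F (V l) := fun l => by
    haveI : FiniteDimensional F
      (Submodule.span F (Set.range (X : Fin n → MvPolynomial (Fin n) F))) :=
      FiniteDimensional.span_of_finite F (Set.finite_range _)
    exact Submodule.finiteDimensional_of_le (hV l)
  have hQ : ∀ l, ∃ Q : Polynomial F, Q ≠ 0 ∧ Q.natDegree ≤ n * k ^ 2 ∧ ∀ α, Q.eval α ≠ 0 →
      ∀ p ∈ (V l).map φ.toLinearMap,
        (∀ b : Fin k, p.eval (α ^ (b.1 + 1)) = 0) → p = 0 := by
    intro l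
    haveI := hfin l
    apply aux_main
    · rintro _ ⟨v, hv, rfl⟩
      obtain ⟨c, rfl⟩ := (Submodule.mem_span_range_iff_exists_fun _).1 (hV l hv)
      rw [AlgHom.toLinearMap_apply, hφ]
      refine Polynomial.natDegree_sum_le_of_forall_le _ _ fun i _ => ?_
      refine (Polynomial.natDegree_smul_le _ _).trans ?_
      rw [Polynomial.natDegree_X_pow]
      omega
    · exact (Submodule.finrank_map_le _ _).trans (hdim l)
  choose Q hQ0 hQd hQe using hQ
  obtain ⟨α, hα⟩ := Polynomial.exists_eval_ne_zero_of_natDegree_lt_card (∏ l, Q l)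
    (Finset.prod_ne_zero_iff.2 fun l _ => hQ0 l) (by
      refine lt_of_le_of_lt (Nat.cast_le.2 ?_) hF
      refine (Polynomial.natDegree_prod_le _ _).trans
        ((Finset.sum_le_sum fun l _ => hQd l).trans ?_)
      simp [mul_assoc])
  rw [Polynomial.eval_prod, Finset.prod_ne_zero_iff] at hα
  refine ⟨α, fun l v hv w hw hvw => ?_⟩
  have hu : v - w ∈ V l := (V l).sub_mem hv hw
  rw [← sub_eq_zero, ← map_sub] at hvw
  rw [← sub_eq_zero]
  generalize v - w = u at hu hvw
  have hz : φ u = 0 := by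
    refine hQe l α (hα l (Finset.mem_univ _)) _ ⟨u, hu, rfl⟩ fun b => ?_
    have hcomp : ((aeval (Pi.single b (1 : F)) : MvPolynomial (Fin k) F →ₐ[F] F).comp
        (aeval fun i : Fin n => ∑ j : Fin k,
          MvPolynomial.C (α ^ ((i.1 + 1) * (j.1 + 1))) * (X j : MvPolynomial (Fin k) F)))
        = (Polynomial.aeval (α ^ (b.1 + 1))).comp φ := by
      apply MvPolynomial.algHom_ext
      intro i
      simp [φ, Pi.single_apply, ← pow_mul, mul_comm]
    have := congrArg (fun f => f u) hcomp
    simp only [AlgHom.comp_apply, hvw, map_zero] at this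
    simpa [Polynomial.coe_aeval_eq_eval] using this.symm
  obtain ⟨c, rfl⟩ := (Submodule.mem_span_range_iff_exists_fun _).1 (hV l hu)
  rw [hφ] at hz
  refine Finset.sum_eq_zero fun i _ => ?_
  have := congrArg (fun p => Polynomial.coeff p (i.1 + 1)) hz
  simp [Polynomial.finsetSum_coeff, Polynomial.coeff_X_pow, ← Fin.ext_iff] at this
  simp [this]
end

section
/- Let F be a field of characteristic zero, let M = (x_{ij}) be the n×n matrix of distinct indeterminates, and let Det_n ∈ F[x_{11}, …, x_{nn}] be its determinant. Suppose Det_n = C(T_1, …, T_m) for some polynomial C ∈ F[y_1, …, y_m] and T_1, …, T_m ∈ F[x_{11}, …, x_{nn}], where T_1, …, T_r are algebraically independent over F, every T_i is algebraic over F(T_1, …, T_r), and r < n. Then there exist a set S of r+1 of the variables x_{ij}, a nonempty set D of diagonal indices j with x_{jj} ∈ S, and nonzero constants c_j ∈ F for j ∈ D, such that Σ_{j ∈ D} c_j · f_j · M_j = 0, where M_j is the first-order principal minor of M with respect to j, f_j is the determinant of the r×r submatrix of the Jacobian (∂T_i/∂x)_{i ∈ {1,…,r}, x ∈ S} obtained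 by deleting the column indexed by x_{jj}, and not all of the f_j for j ∈ D are zero. -/
open MvPolynomial

lemma der_zero_of_alg {F R M K : Type*} [Field F] [CharZero F] [CommRing R] [IsDomain R] [Algebra F R]
    [Field K] [Algebra R K] [IsFractionRing R K]
    [AddCommGroup M] [Module F M] [Module R M] [Module K M] [IsScalarTower R K M]
    (D : Derivation F R M) (s : Set R) (hs : ∀ t ∈ s, D t = 0) (y : R)
    (hy : IsAlgebraic (Algebra.adjoin F s) y) : D y = 0 := by
  have h0 : ∀ a ∈ Algebra.adjoin F s, D a = 0 := by
    intro a ha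
    induction ha using Algebra.adjoin_induction with
    | mem x hx => exact hs x hx
    | algebraMap r => simp
    | add x y _ _ hx hy => simp [hx, hy]
    | mul x y _ _ hx hy => simp [hx, hy]
  have : CharZero R := charZero_of_injective_algebraMap (algebraMap F R).injective
  let L : R →ₗ[Algebra.adjoin F s] M :=
    { toFun := D
      map_add' := by simp
      map_smul' := by
        intro a x
        have : a • x = (a : R) * x := rfl
        rw [this, D.leibniz, h0 a a.2]
        simp
        rfl }
  let D' : Derivation (Algebra.adjoin F s) R M := Derivation.mk' L (by intro a b; exact D.leibniz a b)
  have key : ∀ (n : ℕ) (p : Polynomial (Algebra.adjoin F s)), p.natDegree = n → p ≠ 0 →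
      Polynomial.aeval y p = 0 → D y = 0 := by
    intro n
    induction n using Nat.strong_induction_on with
    | _ n ih =>
      intro p hn hp hpy
      have h1 : Polynomial.aeval y (Polynomial.derivative p) • D y = 0 := by
        have := D'.map_aeval p y
        rw [hpy, map_zero] at this
        exact this.symm
      by_cases h2 : Polynomial.aeval y (Polynomial.derivative p) = 0
      · by_cases h3 : p.natDegree = 0
        · exfalso
          rw [Polynomial.natDegree_eq_zero] at h3
          obtain ⟨a, rfl⟩ := h3
          rw [Polynomial.aeval_C] at hpy
          apply hp
          have : a = 0 := Subtype.ext hpy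
          simp [this]
        · refine ih _ ?_ _ rfl ?_ h2
          · rw [← hn]; exact Polynomial.natDegree_derivative_lt h3
          · intro h4
            exact h3 (Polynomial.derivative_eq_zero.1 h4)
      · rw [← algebraMap_smul K] at h1
        rcases smul_eq_zero.1 h1 with h | h
        · exact absurd ((IsFractionRing.injective R K) (by rw [h, map_zero])) h2
        · exact h
  obtain ⟨p, hp, hpy⟩ := hy
  exact key _ p rfl hp hpy

noncomputable def gradD (F σ : Type*) [Field F] :
    Derivation F (MvPolynomial σ F) (σ → FractionRing (MvPolynomial σ F)) :=
  Derivation.mk' (LinearMap.pi fun v =>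
      ((Algebra.linearMap (MvPolynomial σ F) (FractionRing (MvPolynomial σ F))).restrictScalars F) ∘ₗ
        (pderiv v : Derivation F (MvPolynomial σ F) (MvPolynomial σ F)).toLinearMap) (by
    intro a b
    ext v
    simp [Algebra.smul_def])

lemma gradD_apply {F σ : Type*} [Field F] (p : MvPolynomial σ F) (v : σ) :
    gradD F σ p v = algebraMap _ (FractionRing (MvPolynomial σ F)) (pderiv v p) := rfl

lemma gradD_mem {F σ : Type*} [Field F] [CharZero F]
    (W : Submodule (FractionRing (MvPolynomial σ F)) (σ → FractionRing (MvPolynomial σ F)))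
    (s : Set (MvPolynomial σ F)) (hs : ∀ t ∈ s, gradD F σ t ∈ W) (y : MvPolynomial σ F)
    (hy : IsAlgebraic (Algebra.adjoin F s) y) : gradD F σ y ∈ W := by
  have := der_zero_of_alg (K := FractionRing (MvPolynomial σ F))
    ((W.mkQ.restrictScalars (MvPolynomial σ F)).compDer (gradD F σ)) s
    (by intro t ht; simpa using hs t ht) y hy
  simpa using this

lemma gradD_X {F σ : Type*} [Field F] [DecidableEq σ] (v : σ) : gradD F σ (X v) = Pi.single v 1 := by
  ext w
  rw [gradD_apply, pderiv_X]
  by_cases h : v = w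
  · subst h; simp
  · simp [Pi.single_apply, h, Ne.symm h]

lemma gradD_linInd {F σ ι : Type*} [Field F] [CharZero F] [Fintype σ]
    (T : ι → MvPolynomial σ F) (hT : AlgebraicIndependent F T) :
    LinearIndependent (FractionRing (MvPolynomial σ F)) (fun i => gradD F σ (T i)) := by
  classical
  obtain ⟨u, hu, -, hb⟩ := exists_isTranscendenceBasis_between (R := F) (Set.range T) Set.univ
    (Set.subset_univ _) hT.to_subtype_range (ht := by
      rw [Algebra.adjoin_univ]
      exact ⟨fun x => isAlgebraic_algebraMap (⟨x, trivial⟩ : (⊤ : Subalgebra F (MvPolynomial σ F)))⟩)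
  have hc := hb.lift_cardinalMk_eq (IsTranscendenceBasis.mvPolynomial σ F)
  have : Finite u := by
    rw [← Cardinal.mk_lt_aleph0_iff, ← Cardinal.lift_lt_aleph0, hc, Cardinal.lift_lt_aleph0]
    exact Cardinal.mk_lt_aleph0
  have := Fintype.ofFinite u
  have hcard : Fintype.card u = Fintype.card σ := by simpa using hc
  have halg : Algebra.IsAlgebraic _ _ := hb.isAlgebraic
  have hli : LinearIndependent (FractionRing (MvPolynomial σ F)) (fun a : u => gradD F σ a) := by
    apply linearIndependent_of_top_le_span_of_card_eq_finrank
    · have hX : ∀ v : σ, (Pi.single v 1 : σ → FractionRing (MvPolynomial σ F)) ∈ Submodule.span (FractionRing (MvPolynomial σ F)) (Set.range fun a : u => gradD F σ a) := by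
        intro v
        rw [← gradD_X]
        refine gradD_mem _ _ ?_ _ (halg.isAlgebraic (X v))
        rintro _ ⟨a, rfl⟩
        exact Submodule.subset_span ⟨a, rfl⟩
      intro f _
      rw [pi_eq_sum_univ' f]
      refine Submodule.sum_mem _ fun v _ => Submodule.smul_mem _ _ ?_
      convert hX v using 1
    · simp [hcard]
  exact hli.comp (fun i => (⟨T i, hu ⟨i, rfl⟩⟩ : u)) (fun a b h => hT.injective (Subtype.ext_iff.1 h))

lemma der_det_zero {F R n : Type*} [CommRing F] [CommRing R] [Algebra F R] [Fintype n] [DecidableEq n]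
    (D : Derivation F R R) (N : Matrix n n R) (h : ∀ a b, D (N a b) = 0) : D N.det = 0 := by
  let A : Subalgebra F R :=
    { carrier := {x | D x = 0}
      mul_mem' := by intro a b ha hb; simp_all
      add_mem' := by intro a b ha hb; simp_all
      algebraMap_mem' := by intro r; simp }
  have : N = (Matrix.of fun a b => (⟨N a b, h a b⟩ : A)).map A.val := by ext; rfl
  rw [this]
  have h2 := (AlgHom.map_det A.val (Matrix.of fun a b => (⟨N a b, h a b⟩ : A)))
  have h3 : D (A.val (Matrix.of fun a b => (⟨N a b, h a b⟩ : A)).det) = 0 :=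
    (Matrix.of fun a b => (⟨N a b, h a b⟩ : A)).det.2
  rw [h2] at h3
  exact h3

lemma pderiv_det {F : Type*} [Field F] {n : ℕ} (j : Fin n) :
    pderiv (j, j) (Matrix.det (Matrix.of fun i j : Fin n =>
        (X (i, j) : MvPolynomial (Fin n × Fin n) F))) =
    Matrix.det (Matrix.of fun a b : {i : Fin n // i ≠ j} =>
          (X (a.1, b.1) : MvPolynomial (Fin n × Fin n) F)) := by
  set A := Matrix.of fun i j : Fin n => (X (i, j) : MvPolynomial (Fin n × Fin n) F) with hA
  have hz : ∀ k, pderiv (j, j) (A.adjugate k j) = 0 := by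
    intro k
    rw [Matrix.adjugate_apply]
    apply der_det_zero
    intro a b
    rw [Matrix.updateRow_apply]
    split_ifs with h
    · by_cases hb : b = k
      · subst hb; simp
      · simp [Pi.single_apply, hb]
    · simp only [hA, Matrix.of_apply]
      apply pderiv_X_of_ne
      intro h'; simp at h'; exact h h'.1
  rw [Matrix.det_eq_sum_mul_adjugate_row A j, map_sum, Finset.sum_eq_single j]
  · rw [Derivation.leibniz, hz]
    simp only [hA, Matrix.of_apply, pderiv_X_self, smul_zero, zero_add, smul_eq_mul, mul_one]
    rw [Matrix.adjugate_apply, Matrix.twoBlockTriangular_det' _ (fun i => i = j)]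
    · have h1 : ∀ (i1 : Fintype {i // i = j}), @Matrix.det {i // i = j} _ i1 _ _
          (Matrix.toSquareBlockProp (A.updateRow j (Pi.single j 1)) (fun i => i = j)) = 1 := by
        intro i1
        rw [Matrix.det_unique]
        simp [Matrix.toSquareBlockProp, Matrix.updateRow_apply, (default : {i // i = j}).2]
      rw [← hA, h1, one_mul, mul_zero, zero_add]
      congr 1
      ext a b
      simp [Matrix.toSquareBlockProp, Matrix.updateRow_apply, a.2, hA]
    · intro i hi k hk
      subst hi
      simp [hk]
  · intro k _ hk
    rw [Derivation.leibniz, hz]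
    simp only [hA, Matrix.of_apply]
    rw [pderiv_X_of_ne (by intro h; simp at h; exact hk h)]
    simp
  · simp

lemma snoc_alg {F A : Type*} [Field F] [CommRing A] [Algebra F A] {r : ℕ} (x : Fin r → A) (a : A)
    (hx : AlgebraicIndependent F x)
    (h : ¬ AlgebraicIndependent F (Fin.snoc x a : Fin (r + 1) → A)) :
    IsAlgebraic (Algebra.adjoin F (Set.range x)) a := by
  by_contra h'
  apply h
  have := (hx.option_iff_transcendental a).2 h'
  rw [← algebraicIndependent_equiv finSuccEquivLast] at this
  convert this using 1
  ext i
  refine Fin.lastCases ?_ (fun i => ?_) i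
  · simp
  · simp

lemma choose_cols {K V : Type*} [Field K] [Fintype V] {n r : ℕ} (hrn : r < n)
    (J : Matrix (Fin r) V K) (hJ : LinearIndependent K J.row)
    (diag : Fin n → V) (hd : Function.Injective diag) :
    ∃ gg : Fin (r + 1) → V, Function.Injective gg ∧ gg 0 ∈ Set.range diag ∧
      (J.submatrix id (gg ∘ Fin.succ)).det ≠ 0 ∧
      ∀ b, gg b ∉ Set.range diag → (J.submatrix id (gg ∘ b.succAbove)).det = 0 := by
  classical
  have hrank : Module.finrank K (Submodule.span K (Set.range J.col)) = r := by
    rw [← Matrix.rank_eq_finrank_span_cols, hJ.rank_matrix]; simp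
  obtain ⟨B, hBs, -, hBspan, hBli⟩ := exists_linearIndepOn_extension
    (K := K) (v := J.col) (linearIndepOn_empty K J.col) (Set.empty_subset (Set.range diag))
  obtain ⟨B', -, hBB', hspan', hli'⟩ := exists_linearIndepOn_extension
    (K := K) (v := J.col) hBli (Set.subset_univ B)
  have hcard : Fintype.card B' = r := by
    rw [← hrank, linearIndependent_iff_card_eq_finrank_span.1 hli', Set.finrank]
    have hrange : Set.range (fun x : B' => J.col x) = J.col '' B' := by
      rw [Set.image_eq_range]
    have hsp : Submodule.span K (Set.range (fun x : B' => J.col x)) =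
        Submodule.span K (Set.range J.col) := by
      rw [hrange]
      apply le_antisymm
      · exact Submodule.span_mono (Set.image_subset_range _ _)
      · rw [Submodule.span_le, ← Set.image_univ]
        exact hspan'
    rw [hsp]
  have hnot : ∃ d ∈ Set.range diag, d ∉ B := by
    by_contra! h
    have h1 : Fintype.card (Fin n) ≤ Fintype.card B' :=
      Fintype.card_le_of_injective (fun i => (⟨diag i, hBB' (h _ ⟨i, rfl⟩)⟩ : B'))
        (fun a b hab => hd (Subtype.ext_iff.1 hab))
    simp [hcard] at h1
    omega
  obtain ⟨d, hds, hdB⟩ := hnot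
  have hdspan : J.col d ∈ Submodule.span K (J.col '' B) := hBspan ⟨d, hds, rfl⟩
  have hdep : ∀ Q : Set V, insert d B ⊆ Q → ¬ LinearIndepOn K J.col Q := by
    intro Q hQ hli
    exact ((linearIndepOn_insert hdB).1 (hli.mono hQ)).2 hdspan
  have hdB' : d ∉ B' := fun h => hdep B' (Set.insert_subset h hBB') hli'
  let e : Fin r ≃ B' := (Fintype.equivFinOfCardEq hcard).symm
  have hinj : Function.Injective (Fin.cons d (fun k => (e k : V)) : Fin (r + 1) → V) := by
    rw [Fin.cons_injective_iff]
    refine ⟨?_, Subtype.val_injective.comp e.injective⟩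
    rintro ⟨k, hk⟩
    exact hdB' (hk ▸ (e k).2)
  refine ⟨Fin.cons d (fun k => (e k : V)), hinj, ?_, ?_, ?_⟩
  · simpa using hds
  · have : LinearIndependent K (J.submatrix id ((Fin.cons d (fun k => (e k : V)) : Fin (r + 1) → V) ∘ Fin.succ)).col :=
      hli'.comp e e.injective
    rw [Matrix.linearIndependent_cols_iff_isUnit, Matrix.isUnit_iff_isUnit_det] at this
    exact this.ne_zero
  · intro b hb
    by_contra hne
    have h1 := Matrix.linearIndependent_cols_iff_isUnit.2
      ((Matrix.isUnit_iff_isUnit_det _).2 (isUnit_iff_ne_zero.2 hne))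
    set gg : Fin (r + 1) → V := Fin.cons d (fun k => (e k : V)) with hgg
    have h2 : LinearIndepOn K J.col (Set.range (gg ∘ b.succAbove)) :=
      (linearIndepOn_range_iff (hinj.comp Fin.succAbove_right_injective) J.col).2 h1
    refine hdep _ ?_ h2
    have hmem : ∀ k, gg k ∈ Set.range diag → gg k ∈ Set.range (gg ∘ b.succAbove) := by
      intro k hk
      have : k ≠ b := by rintro rfl; exact hb hk
      obtain ⟨l, hl⟩ := Fin.exists_succAbove_eq this
      exact ⟨l, by simp [hl]⟩
    rintro x (rfl | hx)
    · exact hmem 0 (by simpa [hgg] using hds)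
    · have := hmem (Fin.succ (e.symm ⟨x, hBB' hx⟩)) (by simpa [hgg] using hBs hx)
      simpa [hgg] using this

theorem statement7 {F : Type*} [Field F] [CharZero F] {n m r : ℕ}
    (hrm : r ≤ m) (hrn : r < n)
    (T : Fin m → MvPolynomial (Fin n × Fin n) F)
    (C : MvPolynomial (Fin m) F)
    (hdet : Matrix.det (Matrix.of fun i j : Fin n =>
        (X (i, j) : MvPolynomial (Fin n × Fin n) F)) = aeval T C)
    (hind : AlgebraicIndependent F fun i : Fin r => T (Fin.castLE hrm i))
    (halg : ∀ i : Fin m, ¬ AlgebraicIndependent F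
      (Fin.snoc (fun j : Fin r => T (Fin.castLE hrm j)) (T i) :
        Fin (r + 1) → MvPolynomial (Fin n × Fin n) F)) :
    ∃ (S : Finset (Fin n × Fin n)) (D : Finset (Fin n)) (c : Fin n → F)
      (f : Fin n → MvPolynomial (Fin n × Fin n) F),
      S.card = r + 1 ∧ D.Nonempty ∧
      (∀ j ∈ D, (j, j) ∈ S) ∧
      (∀ j ∈ D, c j ≠ 0) ∧
      (∀ j ∈ D, ∃ e : Fin r ≃ {v // v ∈ S.erase (j, j)},
        f j = Matrix.det (Matrix.of fun a b : Fin r =>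
          pderiv (e b).1 (T (Fin.castLE hrm a)))) ∧
      (∃ j ∈ D, f j ≠ 0) ∧
      ∑ j ∈ D, MvPolynomial.C (c j) * f j *
        Matrix.det (Matrix.of fun a b : {i : Fin n // i ≠ j} =>
          (X (a.1, b.1) : MvPolynomial (Fin n × Fin n) F)) = 0 := by
  classical
  let K := FractionRing (MvPolynomial (Fin n × Fin n) F)
  have hinjK : Function.Injective (algebraMap (MvPolynomial (Fin n × Fin n) F) K) :=
    IsFractionRing.injective _ _
  set T' : Fin r → MvPolynomial (Fin n × Fin n) F := fun i => T (Fin.castLE hrm i) with hT'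
  have hli := gradD_linInd T' hind
  set A := Matrix.det (Matrix.of fun i j : Fin n =>
        (X (i, j) : MvPolynomial (Fin n × Fin n) F)) with hA
  let W : Submodule K (Fin n × Fin n → K) := Submodule.span K (Set.range fun i => gradD F _ (T' i))
  have hTW : ∀ i, gradD F _ (T i) ∈ W := by
    intro i
    refine gradD_mem W (Set.range T') ?_ _ (snoc_alg T' (T i) hind (halg i))
    rintro _ ⟨a, rfl⟩
    exact Submodule.subset_span ⟨a, rfl⟩
  have hAW : gradD F _ A ∈ W := by
    refine gradD_mem W (Set.range T) (by rintro _ ⟨a, rfl⟩; exact hTW a) _ ?_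
    rw [hdet]
    have : aeval T C ∈ Algebra.adjoin F (Set.range T) := by
      rw [Algebra.adjoin_range_eq_range_aeval]; exact ⟨C, rfl⟩
    exact isAlgebraic_algebraMap (⟨_, this⟩ : Algebra.adjoin F (Set.range T))
  obtain ⟨gg, hgi, hg0, hgdet, hgz⟩ := choose_cols (K := K) hrn
    (Matrix.of fun i => gradD F _ (T' i)) hli (fun j : Fin n => (j, j))
    (fun a b h => (Prod.ext_iff.1 h).1)
  let G : Fin (r + 1) → MvPolynomial (Fin n × Fin n) F := fun b =>
    Matrix.det (Matrix.of fun a k : Fin r => pderiv (gg (b.succAbove k)) (T' a))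
  have hG : ∀ b, algebraMap _ K (G b) =
      ((Matrix.of fun i => gradD F _ (T' i)).submatrix id (gg ∘ b.succAbove)).det := by
    intro b
    rw [RingHom.map_det]
    rfl
  have hG0 : G 0 ≠ 0 := by
    intro h
    apply hgdet
    have := hG 0
    rw [h, map_zero] at this
    exact this.symm
  have hGz : ∀ b, gg b ∉ Set.range (fun j : Fin n => (j, j)) → G b = 0 := by
    intro b hb
    apply hinjK
    rw [hG, hgz b hb, map_zero]
  have hsum : ∑ b : Fin (r + 1), (-1) ^ (b : ℕ) * pderiv (gg b) A * G b = 0 := by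
    let N : Matrix (Fin (r + 1)) (Fin (r + 1)) (MvPolynomial (Fin n × Fin n) F) :=
      Matrix.of fun a b => pderiv (gg b) ((Fin.cons A T' : Fin (r + 1) → MvPolynomial (Fin n × Fin n) F) a)
    have hN : N.det = 0 := by
      apply hinjK
      rw [RingHom.map_det, map_zero, ← Matrix.exists_vecMul_eq_zero_iff]
      obtain ⟨a, ha⟩ := (Submodule.mem_span_range_iff_exists_fun K).1 hAW
      refine ⟨Fin.cons 1 (fun i => - a i), ?_, ?_⟩
      · intro h
        have := congrFun h 0
        simp at this
      · ext b
        have := congrFun ha (gg b)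
        simp only [Finset.sum_apply, Pi.smul_apply, gradD_apply, smul_eq_mul] at this
        simp [Matrix.vecMul, dotProduct, Fin.sum_univ_succ, N]
        rw [← this]
        simp [K]
    rw [← hN, Matrix.det_succ_row_zero]
    rfl
  let S : Finset (Fin n × Fin n) := Finset.univ.image gg
  let D : Finset (Fin n) := Finset.univ.filter fun j => (j, j) ∈ S
  have hDex : ∀ j ∈ D, ∃ b, gg b = (j, j) := by
    intro j hj
    simpa [D, S] using hj
  let idx : Fin n → Fin (r + 1) := fun j => if h : ∃ b, gg b = (j, j) then h.choose else 0
  have hidx : ∀ j ∈ D, gg (idx j) = (j, j) := by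
    intro j hj
    have h := hDex j hj
    simp only [idx, dif_pos h]
    exact h.choose_spec
  obtain ⟨d, hd⟩ := hg0
  have hdD : d ∈ D := by
    simp only [D, S, Finset.mem_filter, Finset.mem_univ, true_and, Finset.mem_image]
    exact ⟨0, hd.symm⟩
  have hidxd : idx d = 0 := hgi (by rw [hidx d hdD]; exact hd)
  refine ⟨S, D, fun j => (-1) ^ (idx j : ℕ), fun j => G (idx j), ?_, ⟨d, hdD⟩, ?_, ?_, ?_, ?_, ?_⟩
  · simp [S, Finset.card_image_of_injective _ hgi]
  · intro j hj
    exact (Finset.mem_filter.1 hj).2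
  · intro j _
    exact pow_ne_zero _ (by simp)
  · intro j hj
    refine ⟨Equiv.ofBijective (fun b => ⟨gg ((idx j).succAbove b), ?_⟩) ⟨?_, ?_⟩, rfl⟩
    · rw [Finset.mem_erase, ← hidx j hj]
      exact ⟨fun h => Fin.succAbove_ne _ _ (hgi h), Finset.mem_image_of_mem _ (Finset.mem_univ _)⟩
    · intro a b h
      exact Fin.succAbove_right_injective (hgi (Subtype.ext_iff.1 h))
    · rintro ⟨x, hx⟩
      rw [Finset.mem_erase] at hx
      obtain ⟨b, -, rfl⟩ := Finset.mem_image.1 hx.2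
      have : b ≠ idx j := by rintro rfl; exact hx.1 (hidx j hj)
      obtain ⟨l, hl⟩ := Fin.exists_succAbove_eq this
      exact ⟨l, Subtype.ext (by simp [hl])⟩
  · exact ⟨d, hdD, by simpa only [hidxd] using hG0⟩
  · have h1 : ∀ j ∈ D, MvPolynomial.C ((-1 : F) ^ (idx j : ℕ)) * G (idx j) *
        Matrix.det (Matrix.of fun a b : {i : Fin n // i ≠ j} =>
          (X (a.1, b.1) : MvPolynomial (Fin n × Fin n) F)) =
        (-1) ^ (idx j : ℕ) * pderiv (gg (idx j)) A * G (idx j) := by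
      intro j hj
      rw [hidx j hj, hA, pderiv_det]
      simp only [map_pow, map_neg, map_one]
      ring
    rw [Finset.sum_congr rfl h1, ← hsum]
    rw [← Finset.sum_image (s := D) (g := idx)
      (f := fun b : Fin (r + 1) => (-1) ^ (b : ℕ) * pderiv (gg b) A * G b)]
    · apply Finset.sum_subset (Finset.subset_univ _)
      intro b _ hb
      rw [hGz b, mul_zero]
      rintro ⟨j, hj⟩
      apply hb
      have hjD : j ∈ D := by
        simp only [D, S, Finset.mem_filter, Finset.mem_univ, true_and, Finset.mem_image]
        exact ⟨b, hj.symm⟩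
      exact Finset.mem_image.2 ⟨j, hjD, hgi (by rw [hidx j hjD]; exact hj)⟩
    · intro a ha b hb h
      have := congrArg gg h
      rw [hidx a ha, hidx b hb] at this
      exact (Prod.ext_iff.1 this).1
end
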